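/- arXiv:2007.06999 — 2 statements merged into one kernel-verified Lean document; each statement's English description precedes it below -/
import Mathlib

section
/- Let A and B be C*-algebras, let n ≥ 1 be an integer, and let σ : A → B be an anti-*-homomorphism which is completely bounded with constant n, i.e., for every k ≥ 1 and every k×k matrix a = (a_{ij}) with entries in A one has ‖(σ(a_{ij}))_{ij}‖ ≤ n‖a‖. Then for every k ≥ 1 and every k×k matrix b with all entries in the range of σ, one has ‖bᵀ‖ ≤ n‖b‖, where bᵀ denotes the transposed matrix (entries unchanged). (Equivalently, via Roydor's transpose-norm characterization of n-minimality and the *-isomorphism between (A/ker σ)^op and the range of σ, the quotient C*-algebra A/ker σ is n-minimal.) -/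
open scoped Matrix

/-- The operator on the Hilbert space `ℓ²(Fin k; H)` induced by a `k × k` matrix of bounded
operators on a Hilbert space `H`. -/
noncomputable def Matrix.toPiLpCLM {H : Type*} [NormedAddCommGroup H] [InnerProductSpace ℂ H]
    {k : ℕ} (a : Matrix (Fin k) (Fin k) (H →L[ℂ] H)) :
    (PiLp 2 fun _ : Fin k => H) →L[ℂ] (PiLp 2 fun _ : Fin k => H) :=
  ((PiLp.continuousLinearEquiv 2 ℂ (fun _ : Fin k => H)).symm.toContinuousLinearMap) ∘L
    (ContinuousLinearMap.pi fun i => ∑ j, (a i j) ∘L ContinuousLinearMap.proj j) ∘L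
    ((PiLp.continuousLinearEquiv 2 ℂ (fun _ : Fin k => H)).toContinuousLinearMap)

/-- The (unique) C*-norm of a `k × k` matrix of bounded operators on a Hilbert space `H`:
the operator norm of the induced operator on the Hilbert space `ℓ²(Fin k; H)`.  For a matrix
over an abstract C*-algebra, the C*-norm is obtained by applying a faithful representation
entrywise and then taking this norm. -/
noncomputable def Matrix.cstarNorm {H : Type*} [NormedAddCommGroup H] [InnerProductSpace ℂ H]
    {k : ℕ} (a : Matrix (Fin k) (Fin k) (H →L[ℂ] H)) : ℝ :=
  ‖a.toPiLpCLM‖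

/-- A nonunital star homomorphism between unital C⋆-algebras lifts elements of its range without
increasing the norm. -/
theorem NonUnitalStarAlgHom.exists_apply_eq_and_norm_le {C D : Type*} [CStarAlgebra C]
    [CStarAlgebra D] (φ : C →⋆ₙₐ[ℂ] D) (c : C) : ∃ c', φ c' = φ c ∧ ‖c'‖ ≤ ‖φ c‖ := by
  obtain hr | hr := (norm_nonneg (φ c)).eq_or_lt
  · exact ⟨0, by rw [map_zero, eq_comm, ← norm_eq_zero, ← hr], by simp⟩
  have : Nontrivial D := nontrivial_of_ne (φ c) 0 (norm_pos_iff.1 hr)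
  set r := ‖φ c‖
  have hmax (t : ℝ) : 0 < max r √t := lt_max_of_lt_left hr
  let g : ℝ → ℝ := fun t => 1 - r / max r √t
  have hg : Continuous g :=
    continuous_const.sub (continuous_const.div (by fun_prop) fun t => (hmax t).ne')
  have hg_zero : g 0 = 0 := by simp [g, max_eq_left hr.le, hr.ne']
  have hφ : Continuous φ :=
    AddMonoidHomClass.continuous_of_bound φ 1 fun x => by
      simpa using NonUnitalStarAlgHom.norm_apply_le φ x
  have hsa : IsSelfAdjoint (star c * c) := .star_mul_self c
  have hG : φ (cfc g (star c * c)) = 0 := by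
    rw [← cfcₙ_eq_cfc (hf := hg.continuousOn) (hf0 := hg_zero),
      NonUnitalStarAlgHom.map_cfcₙ φ g (star c * c) hg.continuousOn hg_zero hφ hsa
        (hsa.map φ), ← cfcₙ_zero ℝ (φ (star c * c))]
    refine cfcₙ_congr fun t ht => ?_
    have ht' : t ≤ r ^ 2 := by
      rw [quasispectrum_eq_spectrum_union_zero] at ht
      obtain ht | rfl := ht
      · have := spectrum.norm_le_norm_of_mem ht
        rw [map_mul, map_star, CStarRing.norm_star_mul_self, ← sq] at this
        exact (le_abs_self t).trans this
      · positivity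
    simp [g, max_eq_left (Real.sqrt_le_iff.2 ⟨hr.le, ht'⟩), hr.ne']
  refine ⟨c - c * cfc g (star c * c), by rw [map_sub, map_mul, hG, mul_zero, sub_zero], ?_⟩
  have hGsa : star (cfc g (star c * c)) = cfc g (star c * c) := cfc_predicate g (star c * c)
  have key : star (c - c * cfc g (star c * c)) * (c - c * cfc g (star c * c)) =
      cfc (fun t => (1 - g t) * t * (1 - g t)) (star c * c) := by
    rw [cfc_mul (fun t => (1 - g t) * t) (fun t => 1 - g t) _ (by fun_prop) (by fun_prop),
      cfc_mul (fun t => 1 - g t) (fun t => t) _ (by fun_prop) (by fun_prop),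
      cfc_sub (fun _ => 1) g _ (by fun_prop) (by fun_prop), cfc_const_one ℝ (star c * c),
      cfc_id' ℝ (star c * c), star_sub, star_mul, hGsa]
    noncomm_ring
  have hsq : ‖c - c * cfc g (star c * c)‖ ^ 2 ≤ r ^ 2 := by
    rw [sq, ← CStarRing.norm_star_mul_self, key]
    refine norm_cfc_le (by positivity) fun t ht => ?_
    have ht0 : 0 ≤ t := spectrum_star_mul_self_nonneg t ht
    have h1 : (1 - g t) * t * (1 - g t) = r ^ 2 * (√t / max r √t) ^ 2 := by
      nth_rw 2 [← Real.sq_sqrt ht0]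
      simp only [g]
      ring
    rw [h1, Real.norm_of_nonneg (by positivity)]
    refine mul_le_of_le_one_right (by positivity) (pow_le_one₀ (by positivity) ?_)
    exact div_le_one_of_le₀ (le_max_right _ _) (hmax t).le
  exact le_of_sq_le_sq hsq hr.le

section

variable {H : Type*} [NormedAddCommGroup H] [InnerProductSpace ℂ H] {k : ℕ}

@[simp]
theorem Matrix.toPiLpCLM_apply (a : Matrix (Fin k) (Fin k) (H →L[ℂ] H))
    (v : PiLp 2 fun _ : Fin k => H) (i : Fin k) : a.toPiLpCLM v i = ∑ j, a i j (v j) := by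
  simp [Matrix.toPiLpCLM]

theorem Matrix.toPiLpCLM_injective :
    Function.Injective (Matrix.toPiLpCLM (H := H) (k := k)) := by
  intro a b h
  ext i j x
  have hx := congrArg (fun T => T (WithLp.toLp 2 (Pi.single j x)) i) h
  simpa [Pi.single_apply, apply_ite] using hx

/-- `Matrix.toPiLpCLM` as a star homomorphism. -/
noncomputable def Matrix.toPiLpCLMHom [CompleteSpace H] :
    Matrix (Fin k) (Fin k) (H →L[ℂ] H) →⋆ₙₐ[ℂ]
      ((PiLp 2 fun _ : Fin k => H) →L[ℂ] (PiLp 2 fun _ : Fin k => H)) where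
  toFun := Matrix.toPiLpCLM
  map_smul' c a := by ext v i; simp [Finset.smul_sum]
  map_zero' := by ext v i; simp
  map_add' a b := by ext v i; simp [Finset.sum_add_distrib]
  map_mul' a b := by
    ext v i
    simp only [Matrix.toPiLpCLM_apply, mul_apply_eq_comp, Matrix.mul_apply,
      _root_.sum_apply, map_sum]
    exact Finset.sum_comm
  map_star' a := by
    rw [ContinuousLinearMap.star_eq_adjoint, ContinuousLinearMap.eq_adjoint_iff]
    intro v w
    simp only [PiLp.inner_apply, Matrix.toPiLpCLM_apply, sum_inner, inner_sum, Matrix.star_apply,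
      ContinuousLinearMap.star_eq_adjoint, ContinuousLinearMap.adjoint_inner_left]
    exact Finset.sum_comm

end

/-- **Lemma 4.1 of Arhancet.**  If `σ : A → B` is an anti-*-homomorphism between C*-algebras
which is completely bounded with constant `n`, then every matrix with entries in the range of
`σ` satisfies the transpose-norm bound `‖bᵀ‖ ≤ n‖b‖` (i.e. by Roydor's characterization, the
quotient `A / ker σ` is `n`-minimal).  Matrix C*-norms are computed via the given faithful
representations `ρA` and `ρB`. -/
theorem range_of_cb_anti_star_hom_transpose_norm_bound
    {A B HA HB : Type*} [CStarAlgebra A] [CStarAlgebra B]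
    [NormedAddCommGroup HA] [InnerProductSpace ℂ HA] [CompleteSpace HA]
    [NormedAddCommGroup HB] [InnerProductSpace ℂ HB] [CompleteSpace HB]
    (ρA : A →⋆ₐ[ℂ] (HA →L[ℂ] HA)) (hρA : Function.Injective ρA)
    (ρB : B →⋆ₐ[ℂ] (HB →L[ℂ] HB)) (hρB : Function.Injective ρB)
    (σ : A →ₗ[ℂ] B)
    (hmul : ∀ x y : A, σ (x * y) = σ y * σ x)
    (hstar : ∀ x : A, σ (star x) = star (σ x))
    (n : ℕ) (hn : 1 ≤ n)
    (hcb : ∀ k : ℕ, 1 ≤ k → ∀ a : Matrix (Fin k) (Fin k) A,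
      Matrix.cstarNorm ((a.map ⇑σ).map ⇑ρB) ≤ (n : ℝ) * Matrix.cstarNorm (a.map ⇑ρA)) :
    ∀ k : ℕ, 1 ≤ k → ∀ b : Matrix (Fin k) (Fin k) B,
      (∀ i j, b i j ∈ Set.range ⇑σ) →
      Matrix.cstarNorm ((b.map ⇑ρB)ᵀ) ≤ (n : ℝ) * Matrix.cstarNorm (b.map ⇑ρB) := by
  intro k hk b hb
  choose c hc using hb
  let : PartialOrder A := CStarAlgebra.spectralOrder A
  have : StarOrderedRing A := CStarAlgebra.spectralOrderedRing A
  let R : CStarMatrix (Fin k) (Fin k) A →⋆ₙₐ[ℂ]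
      ((PiLp 2 fun _ : Fin k => HA) →L[ℂ] (PiLp 2 fun _ : Fin k => HA)) :=
    { toFun := fun x => Matrix.toPiLpCLMHom (H := HA) (k := k)
        (Matrix.map (CStarMatrix.ofMatrix.symm x) ρA)
      map_smul' := fun z x => by
        rw [← map_smul]
        congr 1; ext i j : 1; simp
      map_zero' := by
        rw [← map_zero (Matrix.toPiLpCLMHom (H := HA) (k := k))]
        congr 1; ext i j : 1; simp
      map_add' := fun x y => by
        rw [← map_add]
        congr 1; ext i j : 1; simp
      map_mul' := fun x y => by
        rw [← map_mul]
        congr 1; ext i j : 1; simp [Matrix.mul_apply, CStarMatrix.mul_apply]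
      map_star' := fun x => by
        rw [← map_star]
        congr 1; ext i j : 1; exact map_star ρA _ }
  let T : CStarMatrix (Fin k) (Fin k) A →⋆ₙₐ[ℂ]
      ((PiLp 2 fun _ : Fin k => HB) →L[ℂ] (PiLp 2 fun _ : Fin k => HB))ᵐᵒᵖ :=
    { toFun := fun x => .op <| Matrix.toPiLpCLMHom (H := HB) (k := k)
        (((Matrix.map (CStarMatrix.ofMatrix.symm x) σ).map ρB)ᵀ)
      map_smul' := fun z x => by
        rw [← MulOpposite.op_smul, ← map_smul]
        congr 2; ext i j : 1; simp
      map_zero' := by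
        rw [← MulOpposite.op_zero, ← map_zero (Matrix.toPiLpCLMHom (H := HB) (k := k))]
        congr 2; ext i j : 1; simp
      map_add' := fun x y => by
        rw [← MulOpposite.op_add, ← map_add]
        congr 2; ext i j : 1; simp
      map_mul' := fun x y => by
        rw [← MulOpposite.op_mul, ← map_mul]
        congr 2; ext i j : 1
        simp [Matrix.mul_apply, CStarMatrix.mul_apply, hmul]
      map_star' := fun x => by
        rw [← MulOpposite.op_star, ← map_star]
        congr 2; ext i j : 1
        simp [Matrix.star_apply, CStarMatrix.star_apply, hstar, map_star] }
  have hT (x : Matrix (Fin k) (Fin k) A) :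
      T (CStarMatrix.ofMatrix x) = .op (((x.map σ).map ρB)ᵀ).toPiLpCLM := rfl
  obtain ⟨x, hx, hxn⟩ := T.exists_apply_eq_and_norm_le (CStarMatrix.ofMatrix (Matrix.of c)ᵀ)
  obtain ⟨x, rfl⟩ := CStarMatrix.ofMatrix.surjective x
  have hcb' : (((Matrix.of c)ᵀ.map σ).map ρB)ᵀ = b.map ρB := by ext i j : 1; simp [hc]
  rw [hT, hT, hcb', MulOpposite.op_inj] at hx
  rw [hT, hcb', MulOpposite.norm_op] at hxn
  rw [← Matrix.toPiLpCLM_injective hx] at hxn ⊢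
  rw [Matrix.transpose_transpose]
  calc Matrix.cstarNorm ((x.map σ).map ρB)
      ≤ n * Matrix.cstarNorm (x.map ρA) := hcb k hk x
    _ ≤ n * ‖CStarMatrix.ofMatrix x‖ := by
        gcongr
        exact NonUnitalStarAlgHom.norm_apply_le R (CStarMatrix.ofMatrix x)
    _ ≤ _ := by gcongr; exact hxn
end

section
/- Let A and B be C*-algebras and let n ≥ 1 be an integer. Let π : A → B be a *-homomorphism and let σ : A → B be an anti-*-homomorphism, and set J = π + σ. Suppose that A satisfies the transpose-norm bound with constant n, i.e., for every k ≥ 1 and every k×k matrix a with entries in A one has ‖aᵀ‖ ≤ n‖a‖. Then J is completely bounded with constant n + 1: for every k ≥ 1 and every k×k matrix a = (a_{ij}) over A, ‖(J(a_{ij}))_{ij}‖ ≤ (n+1)‖a‖. -/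
open scoped Matrix

open CStarMatrix in
/-- Square matrices of operators on `H`, represented on `ℓ²(Fin k; H)` by `Matrix.toPiLpCLM`. -/
noncomputable def CStarMatrix.toPiLpCLMStarHom (H : Type*) [NormedAddCommGroup H]
    [InnerProductSpace ℂ H] [CompleteSpace H] (k : ℕ) :
    CStarMatrix (Fin k) (Fin k) (H →L[ℂ] H) →⋆ₙₐ[ℂ]
      ((PiLp 2 fun _ : Fin k => H) →L[ℂ] (PiLp 2 fun _ : Fin k => H)) where
  toFun a := Matrix.toPiLpCLM (ofMatrix.symm a)
  map_smul' c a := by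
    ext v i
    simp [Matrix.toPiLpCLM, Finset.smul_sum]
  map_zero' := by
    ext v i
    simp [Matrix.toPiLpCLM]
  map_add' a b := by
    ext v i
    simp [Matrix.toPiLpCLM, Finset.sum_add_distrib]
  map_mul' a b := by
    ext v i
    simp only [Matrix.toPiLpCLM, ofMatrix_symm_apply, mul_apply]
    simp only [ContinuousLinearMap.mul_def, ContinuousLinearMap.comp_apply,
      ContinuousLinearEquiv.coe_coe,
      ContinuousLinearMap.coe_pi', _root_.sum_apply,
      ContinuousLinearMap.proj_apply, PiLp.coe_symm_continuousLinearEquiv,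
      PiLp.coe_continuousLinearEquiv, map_sum]
    exact Finset.sum_comm
  map_star' a := by
    rw [ContinuousLinearMap.star_eq_adjoint, ContinuousLinearMap.eq_adjoint_iff]
    intro v w
    simp only [PiLp.inner_apply, Matrix.toPiLpCLM, ofMatrix_symm_apply, star_apply]
    simp [sum_inner, inner_sum, ContinuousLinearMap.star_eq_adjoint,
      ContinuousLinearMap.adjoint_inner_left]
    exact Finset.sum_comm

theorem CStarMatrix.toPiLpCLMStarHom_injective (H : Type*) [NormedAddCommGroup H]
    [InnerProductSpace ℂ H] [CompleteSpace H] (k : ℕ) :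
    Function.Injective (toPiLpCLMStarHom H k) := by
  rw [injective_iff_map_eq_zero]
  intro a ha
  ext i j x
  have h := congrArg (fun T => T (WithLp.toLp 2 (Pi.single j x)) i) ha
  simpa [toPiLpCLMStarHom, Matrix.toPiLpCLM, Pi.single_apply, apply_ite] using h

/-- Through a faithful representation, `Matrix.cstarNorm` is the norm of `CStarMatrix`. -/
theorem Matrix.cstarNorm_map_eq_norm {A H : Type*} [NonUnitalCStarAlgebra A] [PartialOrder A]
    [StarOrderedRing A] [NormedAddCommGroup H] [InnerProductSpace ℂ H] [CompleteSpace H]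
    (ρ : A →⋆ₙₐ[ℂ] (H →L[ℂ] H)) (hρ : Function.Injective ρ) {k : ℕ}
    (a : Matrix (Fin k) (Fin k) A) :
    Matrix.cstarNorm (a.map ρ) = ‖CStarMatrix.ofMatrix a‖ :=
  NonUnitalStarAlgHom.norm_map
    ((CStarMatrix.toPiLpCLMStarHom H k).comp (CStarMatrix.mapₙₐ ρ))
    ((CStarMatrix.toPiLpCLMStarHom_injective H k).comp (CStarMatrix.map_injective hρ))
    (CStarMatrix.ofMatrix a)

open CStarMatrix in
/-- An anti-*-homomorphism applied entrywise is contractive up to a transposition. -/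
theorem CStarMatrix.norm_map_le_norm_transpose {A B : Type*}
    [NonUnitalCStarAlgebra A] [PartialOrder A] [StarOrderedRing A]
    [NonUnitalCStarAlgebra B] [PartialOrder B] [StarOrderedRing B]
    (σ : A →ₗ[ℂ] B) (hmul : ∀ x y : A, σ (x * y) = σ y * σ x)
    (hstar : ∀ x : A, σ (star x) = star (σ x)) {m : Type*} [Fintype m]
    (a : CStarMatrix m m A) : ‖a.map σ‖ ≤ ‖a.transpose‖ := by
  let : NonUnitalCStarAlgebra (CStarMatrix m m B)ᵐᵒᵖ := {}
  let φ : CStarMatrix m m A →⋆ₙₐ[ℂ] (CStarMatrix m m B)ᵐᵒᵖ :=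
    { toFun := fun b => MulOpposite.op (b.transpose.map σ)
      map_smul' := fun c b => MulOpposite.unop_injective <| by ext; simp
      map_zero' := MulOpposite.unop_injective <| by ext; simp
      map_add' := fun b c => MulOpposite.unop_injective <| by ext; simp
      map_mul' := fun b c => MulOpposite.unop_injective <| by ext; simp [mul_apply, hmul]
      map_star' := fun b => MulOpposite.unop_injective <| by ext; simp [star_apply, hstar] }
  exact NonUnitalStarAlgHom.norm_apply_le φ a.transpose

/-- If the C*-algebra `A` satisfies the transpose-norm bound with constant `n` (Roydor's
characterization of `n`-minimality), `π : A → B` is a *-homomorphism and `σ : A → B` is an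
anti-*-homomorphism, then `J = π + σ` is completely bounded with constant `n + 1`.  Matrix
C*-norms are computed via the given faithful representations `ρA` and `ρB`. -/
theorem sum_star_hom_anti_star_hom_cb_of_transpose_norm_bound
    {A B HA HB : Type*} [CStarAlgebra A] [CStarAlgebra B]
    [NormedAddCommGroup HA] [InnerProductSpace ℂ HA] [CompleteSpace HA]
    [NormedAddCommGroup HB] [InnerProductSpace ℂ HB] [CompleteSpace HB]
    (ρA : A →⋆ₐ[ℂ] (HA →L[ℂ] HA)) (hρA : Function.Injective ρA)
    (ρB : B →⋆ₐ[ℂ] (HB →L[ℂ] HB)) (hρB : Function.Injective ρB)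
    (π σ : A →ₗ[ℂ] B)
    (hπmul : ∀ x y : A, π (x * y) = π x * π y)
    (hπstar : ∀ x : A, π (star x) = star (π x))
    (hσmul : ∀ x y : A, σ (x * y) = σ y * σ x)
    (hσstar : ∀ x : A, σ (star x) = star (σ x))
    (n : ℕ) (hn : 1 ≤ n)
    (htr : ∀ k : ℕ, 1 ≤ k → ∀ a : Matrix (Fin k) (Fin k) A,
      Matrix.cstarNorm ((a.map ⇑ρA)ᵀ) ≤ (n : ℝ) * Matrix.cstarNorm (a.map ⇑ρA)) :
    ∀ k : ℕ, 1 ≤ k → ∀ a : Matrix (Fin k) (Fin k) A,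
      Matrix.cstarNorm ((a.map fun x => π x + σ x).map ⇑ρB) ≤
        ((n : ℝ) + 1) * Matrix.cstarNorm (a.map ⇑ρA) := by
  intro k hk a
  let : PartialOrder A := CStarAlgebra.spectralOrder A
  have : StarOrderedRing A := CStarAlgebra.spectralOrderedRing A
  let : PartialOrder B := CStarAlgebra.spectralOrder B
  have : StarOrderedRing B := CStarAlgebra.spectralOrderedRing B
  have hA (b : Matrix (Fin k) (Fin k) A) :
      Matrix.cstarNorm (b.map ⇑ρA) = ‖CStarMatrix.ofMatrix b‖ :=
    Matrix.cstarNorm_map_eq_norm (ρA : A →⋆ₙₐ[ℂ] (HA →L[ℂ] HA)) hρA b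
  have hB (b : Matrix (Fin k) (Fin k) B) :
      Matrix.cstarNorm (b.map ⇑ρB) = ‖CStarMatrix.ofMatrix b‖ :=
    Matrix.cstarNorm_map_eq_norm (ρB : B →⋆ₙₐ[ℂ] (HB →L[ℂ] HB)) hρB b
  let π' : A →⋆ₙₐ[ℂ] B :=
    { toFun := π
      map_smul' := π.map_smul
      map_zero' := π.map_zero
      map_add' := π.map_add
      map_mul' := hπmul
      map_star' := hπstar }
  let M := CStarMatrix.ofMatrix a
  have hπ : ‖M.map π‖ ≤ ‖M‖ := NonUnitalStarAlgHom.norm_apply_le (CStarMatrix.mapₙₐ π') M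
  have hσ : ‖M.map σ‖ ≤ ‖M.transpose‖ :=
    CStarMatrix.norm_map_le_norm_transpose σ hσmul hσstar M
  have ht : ‖M.transpose‖ ≤ n * ‖M‖ := by
    have h := htr k hk a
    rwa [← Matrix.transpose_map, hA, hA] at h
  rw [hA, hB]
  calc ‖M.map π + M.map σ‖ ≤ ‖M.map π‖ + ‖M.map σ‖ := norm_add_le _ _
    _ ≤ (n + 1) * ‖M‖ := by linarith
end
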